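/- arXiv:2509.01424 — 4 statements merged into one kernel-verified Lean document; each statement's English description precedes it below -/
import Mathlib

section
/- Fix d ≥ 1, finite nonempty types 𝒳₁,…,𝒳_d, and maps T_i : 𝒳_i → 𝒳_{i+1} for 1 ≤ i ≤ d−1. Let P and Q be pmfs on 𝒳₁ with Q(x) > 0 for all x, and let P^{(i)}, Q^{(i)} be their hierarchical pushforwards (P^{(1)} := P, P^{(i+1)}(y) := ∑_{x : T_i(x)=y} P^{(i)}(x), and similarly for Q). Let σ₁,…,σ_d be positive reals with σ̄_i := σ₁+⋯+σ_i. Then ∑_{i=1}^d σ_i D(P^{(i)}‖Q^{(i)}) = ∑_{i=1}^{d−1} σ̄_i · ∑_{y : P^{(i+1)}(y)>0} P^{(i+1)}(y) · D(P^{(i)}(·|y) ‖ Q^{(i)}(·|y)) + σ̄_d · D(P^{(d)}‖Q^{(d)}), where P^{(i)}(x|y) := P^{(i)}(x)·𝟙[T_i(x)=y]/P^{(i+1)}(y) and Q^{(i)}(x|y) := Q^{(i)}(x)·𝟙[T_i(x)=y]/Q^{(i+1)}(y). -/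
open Finset

/-- Relative entropy of finite pmfs: `D(R‖S) = ∑_{x : R x > 0} R x log (R x / S x)`. -/
noncomputable def relEnt {α : Type*} [Fintype α] (R S : α → ℝ) : ℝ :=
  ∑ x ∈ Finset.univ.filter (fun x => 0 < R x), R x * Real.log (R x / S x)

/-- Hierarchical pushforwards: `hpush T P 0 = P` and
`hpush T P (i+1) y = ∑_{x : T i x = y} hpush T P i x`. -/
noncomputable def hpush {X : ℕ → Type*} [∀ i, Fintype (X i)] [∀ i, DecidableEq (X i)]
    (T : ∀ i, X i → X (i + 1)) (P : X 0 → ℝ) : ∀ i, X i → ℝ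
  | 0 => P
  | i + 1 => fun y => ∑ x ∈ Finset.univ.filter (fun x => T i x = y), hpush T P i x

/-- Accumulated hierarchical coefficients `σ̄_i = σ_0 + ⋯ + σ_i` (0-based). -/
noncomputable def sbar (σ : ℕ → ℝ) (i : ℕ) : ℝ := ∑ k ∈ Finset.range (i + 1), σ k

theorem relEnt_eq_sum {α : Type*} [Fintype α] {R : α → ℝ} (S : α → ℝ) (hR : ∀ x, 0 ≤ R x) :
    relEnt R S = ∑ x, R x * Real.log (R x / S x) := by
  unfold relEnt
  refine Finset.sum_subset (Finset.filter_subset _ _) fun x _ hx => ?_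
  have h0 : R x = 0 := le_antisymm (by simpa using hx) (hR x)
  simp [h0]

theorem mul_relEnt_cond {α β : Type*} [Fintype α] [DecidableEq β] (f : α → β) {R S : α → ℝ}
    (hR : ∀ x, 0 ≤ R x) (hRS : ∀ x, 0 < R x → 0 < S x) (y : β) {r s : ℝ}
    (hr : 0 < r) (hs : 0 < s) :
    r * relEnt (fun x => (if f x = y then R x else 0) / r)
        (fun x => (if f x = y then S x else 0) / s) =
      ∑ x with f x = y, (R x * Real.log (R x / S x) - R x * Real.log (r / s)) := by
  rw [relEnt_eq_sum, Finset.mul_sum, Finset.sum_filter]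
  · refine Finset.sum_congr rfl fun x _ => ?_
    split_ifs with hxy
    · rcases (hR x).eq_or_lt with h | h
      · simp [← h]
      · have hS := hRS x h
        rw [div_div_div_comm, Real.log_div (div_pos h hS).ne' (div_pos hr hs).ne']
        field_simp
    · simp
  · intro x
    have := hR x
    positivity

/-- Chain rule for the relative entropy along a map `f`. -/
theorem relEnt_eq_cond_add_push {α β : Type*} [Fintype α] [Fintype β] [DecidableEq β]
    (f : α → β) {R S : α → ℝ} {R' S' : β → ℝ} (hR : ∀ x, 0 ≤ R x)
    (hRS : ∀ x, 0 < R x → 0 < S x) (hR' : ∀ y, R' y = ∑ x with f x = y, R x)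
    (hRS' : ∀ y, 0 < R' y → 0 < S' y) :
    relEnt R S =
      (∑ y with 0 < R' y, R' y *
        relEnt (fun x => (if f x = y then R x else 0) / R' y)
          (fun x => (if f x = y then S x else 0) / S' y)) + relEnt R' S' := by
  have hzero : ∀ y, ¬ 0 < R' y → ∀ x, f x = y → R x = 0 := by
    intro y hy x hx
    refine le_antisymm (le_trans ?_ (not_lt.mp hy)) (hR x)
    rw [hR']
    exact Finset.single_le_sum (fun z _ => hR z) (by simpa using hx)
  have hcond : ∀ y ∈ Finset.univ.filter (fun y => 0 < R' y), R' y *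
      relEnt (fun x => (if f x = y then R x else 0) / R' y)
        (fun x => (if f x = y then S x else 0) / S' y) + R' y * Real.log (R' y / S' y) =
      ∑ x with f x = y, R x * Real.log (R x / S x) := by
    intro y hy
    have hpos : 0 < R' y := by simpa using hy
    rw [mul_relEnt_cond f hR hRS y hpos (hRS' y hpos), Finset.sum_sub_distrib,
      ← Finset.sum_mul, ← hR', sub_add_cancel]
  rw [relEnt_eq_sum S hR, relEnt.eq_def R' S', ← Finset.sum_add_distrib,
    Finset.sum_congr rfl hcond, ← Finset.sum_fiberwise Finset.univ f]
  symm
  refine Finset.sum_subset (Finset.filter_subset _ _) fun y _ hy => ?_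
  refine Finset.sum_eq_zero fun x hx => ?_
  rw [hzero y (by simpa using hy) x (by simpa using hx), zero_mul]

theorem hpush_nonneg {X : ℕ → Type*} [∀ i, Fintype (X i)] [∀ i, DecidableEq (X i)]
    (T : ∀ i, X i → X (i + 1)) {P : X 0 → ℝ} (hP : ∀ x, 0 ≤ P x) :
    ∀ i x, 0 ≤ hpush T P i x
  | 0, x => hP x
  | i + 1, _ => Finset.sum_nonneg fun x _ => hpush_nonneg T hP i x

theorem hpush_pos_of_hpush_pos {X : ℕ → Type*} [∀ i, Fintype (X i)] [∀ i, DecidableEq (X i)]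
    (T : ∀ i, X i → X (i + 1)) {P Q : X 0 → ℝ} (hP : ∀ x, 0 ≤ P x) (hQ : ∀ x, 0 ≤ Q x)
    (hPQ : ∀ x, 0 < P x → 0 < Q x) : ∀ i x, 0 < hpush T P i x → 0 < hpush T Q i x
  | 0, x, h => hPQ x h
  | i + 1, y, h => by
    simp only [hpush] at h ⊢
    rw [Finset.sum_pos_iff_of_nonneg fun x _ => hpush_nonneg T hP i x] at h
    rw [Finset.sum_pos_iff_of_nonneg fun x _ => hpush_nonneg T hQ i x]
    obtain ⟨x, hx, hpos⟩ := h
    exact ⟨x, hx, hpush_pos_of_hpush_pos T hP hQ hPQ i x hpos⟩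

/-- Summation by parts for a sequence `a` with differences `a i - a (i + 1) = c i`. -/
theorem sum_mul_eq_sum_sbar_mul (σ a c : ℕ → ℝ) (h : ∀ i, a i = c i + a (i + 1)) (n : ℕ) :
    ∑ i ∈ Finset.range (n + 1), σ i * a i =
      ∑ i ∈ Finset.range n, sbar σ i * c i + sbar σ n * a n := by
  induction n with
  | zero => simp [sbar]
  | succ n ih =>
    have hs : sbar σ (n + 1) = sbar σ n + σ (n + 1) := Finset.sum_range_succ _ _
    rw [Finset.sum_range_succ, ih, Finset.sum_range_succ _ n, hs, h n]
    ring

/-- Hierarchical relative entropy equals the weighted sum of conditional relative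
entropies with accumulated coefficients, plus the top-level term. (Levels are
0-based: `X 0, …, X (d-1)` are the types `𝒳₁, …, 𝒳_d` of the paper.) -/
theorem stmt_4 (d : ℕ) (hd : 1 ≤ d) (X : ℕ → Type*) [∀ i, Fintype (X i)]
    [∀ i, Nonempty (X i)] [∀ i, DecidableEq (X i)]
    (T : ∀ i, X i → X (i + 1)) (σ : ℕ → ℝ) (hσ : ∀ i, i < d → 0 < σ i)
    (P Q : X 0 → ℝ) (hP0 : ∀ x, 0 ≤ P x) (hP1 : ∑ x, P x = 1)
    (hQpos : ∀ x, 0 < Q x) (hQ1 : ∑ x, Q x = 1) :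
    ∑ i ∈ Finset.range d, σ i * relEnt (hpush T P i) (hpush T Q i) =
      (∑ i ∈ Finset.range (d - 1), sbar σ i *
        ∑ y ∈ Finset.univ.filter (fun y => 0 < hpush T P (i + 1) y),
          hpush T P (i + 1) y *
            relEnt
              (fun x => (if T i x = y then hpush T P i x else 0) / hpush T P (i + 1) y)
              (fun x => (if T i x = y then hpush T Q i x else 0) / hpush T Q (i + 1) y)) +
      sbar σ (d - 1) * relEnt (hpush T P (d - 1)) (hpush T Q (d - 1)) := by
  obtain ⟨n, rfl⟩ := Nat.exists_eq_add_of_le' hd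
  have hpos := hpush_pos_of_hpush_pos T hP0 (fun x => (hQpos x).le) fun x _ => hQpos x
  exact sum_mul_eq_sum_sbar_mul σ (fun i => relEnt (hpush T P i) (hpush T Q i)) _
    (fun i => relEnt_eq_cond_add_push (T i) (hpush_nonneg T hP0 i) (hpos i)
      (fun _ => rfl) (hpos (i + 1))) n
end

section
/- In the setting of the renormalization-group construction (finite nonempty types 𝒳₁,…,𝒳_d, surjective maps T_i : 𝒳_i → 𝒳_{i+1}, positive weights σ₁,…,σ_d with σ̄_i := σ₁+⋯+σ_i, loss L : 𝒳₁ → ℝ, and for each λ ∈ ℝ the iterates Z₁(λ) := ∑_x exp(−(λ/σ₁)L(x)), P¹_λ(x) := exp(−(λ/σ₁)L(x))/Z₁(λ), Uⁱ_λ := pushforward of Pⁱ_λ under T_i, Z_{i+1}(λ) := ∑_y Uⁱ_λ(y)^{σ̄_i/σ̄_{i+1}}, P^{i+1}_λ(y) := Uⁱ_λ(y)^{σ̄_i/σ̄_{i+1}}/Z_{i+1}(λ), and P̃^{[λ]}(x) := P^d_λ(x^{(d)})∏_{i=1}^{d−1}Pⁱ_λ(x^{(i)})/Uⁱ_λ(x^{(i+1)})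 with x^{(1)}:=x, x^{(i+1)}:=T_i(x^{(i)})), the function F(λ) := ∑_{i=1}^d σ̄_i log Z_i(λ) is differentiable at every λ ∈ ℝ with derivative F′(λ) = −∑_{x∈𝒳₁} P̃^{[λ]}(x) L(x). In particular, if λ* satisfies ∑_x P̃^{[λ*]}(x) L(x) = μ, then F′(λ*) = −μ. -/
open Finset

/-- Shannon entropy (natural log) of a pmf on a finite type, with `0 * log 0 = 0`. -/
noncomputable def entropy {α : Type*} [Fintype α] (R : α → ℝ) : ℝ :=
  -∑ x, R x * Real.log (R x)

/-- The renormalization-group iterates `Pⁱ`: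
`P⁰ x = exp(-(λ/σ₀) L x) / Z₀` and
`P^{i+1} y = (Uⁱ y)^{σ̄_i/σ̄_{i+1}} / Z_{i+1}`, where `Uⁱ` is the pushforward
of `Pⁱ` under `T i` and `Z`'s are the normalizing constants. -/
noncomputable def RGP {X : ℕ → Type*} [∀ i, Fintype (X i)] [∀ i, DecidableEq (X i)]
    (T : ∀ i, X i → X (i + 1)) (σ : ℕ → ℝ) (L : X 0 → ℝ) (lam : ℝ) : ∀ i, X i → ℝ
  | 0 => fun x => Real.exp (-(lam / σ 0) * L x) / ∑ x', Real.exp (-(lam / σ 0) * L x')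
  | i + 1 => fun y =>
      (∑ x ∈ Finset.univ.filter (fun x => T i x = y), RGP T σ L lam i x) ^
          (sbar σ i / sbar σ (i + 1)) /
        ∑ y', (∑ x ∈ Finset.univ.filter (fun x => T i x = y'), RGP T σ L lam i x) ^
          (sbar σ i / sbar σ (i + 1))

/-- The coarse-grained distribution `Uⁱ`, the pushforward of `Pⁱ` under `T i`. -/
noncomputable def RGU {X : ℕ → Type*} [∀ i, Fintype (X i)] [∀ i, DecidableEq (X i)]
    (T : ∀ i, X i → X (i + 1)) (σ : ℕ → ℝ) (L : X 0 → ℝ) (lam : ℝ)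
    (i : ℕ) (y : X (i + 1)) : ℝ :=
  ∑ x ∈ Finset.univ.filter (fun x => T i x = y), RGP T σ L lam i x

/-- The renormalization-group normalizing constants `Z_i`. -/
noncomputable def RGZ {X : ℕ → Type*} [∀ i, Fintype (X i)] [∀ i, DecidableEq (X i)]
    (T : ∀ i, X i → X (i + 1)) (σ : ℕ → ℝ) (L : X 0 → ℝ) (lam : ℝ) : ℕ → ℝ
  | 0 => ∑ x, Real.exp (-(lam / σ 0) * L x)
  | i + 1 => ∑ y, RGU T σ L lam i y ^ (sbar σ i / sbar σ (i + 1))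

/-- The hierarchical trajectory `x^{(i)}` of a point `x`. -/
def liftT {X : ℕ → Type*} (T : ∀ i, X i → X (i + 1)) : ∀ i, X 0 → X i
  | 0 => id
  | i + 1 => fun x => T i (liftT T i x)

/-- The distribution `P̃^{[λ]}`, obtained by disintegration:
`P̃^{[λ]}(x) = P^{d-1}(x^{(d-1)}) ∏_{i<d-1} Pⁱ(x^{(i)}) / Uⁱ(x^{(i+1)})`. -/
noncomputable def Ptilde {X : ℕ → Type*} [∀ i, Fintype (X i)] [∀ i, DecidableEq (X i)]
    (T : ∀ i, X i → X (i + 1)) (σ : ℕ → ℝ) (L : X 0 → ℝ) (lam : ℝ)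
    (d : ℕ) (x : X 0) : ℝ :=
  RGP T σ L lam (d - 1) (liftT T (d - 1) x) *
    ∏ i ∈ Finset.range (d - 1),
      (RGP T σ L lam i (liftT T i x) / RGU T σ L lam i (liftT T (i + 1) x))

/-- The unnormalized log-weights of the renormalization-group construction:
`G⁰ x = -λ L x` and `G^{i+1} y = σ̄_i log ∑_{x : T_i x = y} exp (Gⁱ x / σ̄_i)`. -/
noncomputable def logWeight {X : ℕ → Type*} [∀ i, Fintype (X i)] [∀ i, DecidableEq (X i)]
    (T : ∀ i, X i → X (i + 1)) (σ : ℕ → ℝ) (L : X 0 → ℝ) (lam : ℝ) : ∀ i, X i → ℝ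
  | 0 => fun x => -lam * L x
  | i + 1 => fun y => sbar σ i * Real.log
      (∑ x ∈ Finset.univ.filter (fun x => T i x = y),
        Real.exp (logWeight T σ L lam i x / sbar σ i))

/-- The conditional expectation of `L` given the `i`-th coarse-graining, under the
disintegrated distribution. -/
noncomputable def condLoss {X : ℕ → Type*} [∀ i, Fintype (X i)] [∀ i, DecidableEq (X i)]
    (T : ∀ i, X i → X (i + 1)) (σ : ℕ → ℝ) (L : X 0 → ℝ) (lam : ℝ) : ∀ i, X i → ℝ
  | 0 => L
  | i + 1 => fun y => ∑ x ∈ Finset.univ.filter (fun x => T i x = y),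
      RGP T σ L lam i x / RGU T σ L lam i y * condLoss T σ L lam i x

lemma sbar_pos {σ : ℕ → ℝ} {n : ℕ} (hσ : ∀ i ≤ n, 0 < σ i) : 0 < sbar σ n :=
  Finset.sum_pos (fun i hi => hσ i (Nat.lt_succ_iff.mp (Finset.mem_range.mp hi))) (by simp)

/-- The derivative of a log-sum-exp is the Gibbs average of the derivatives. -/
lemma hasDerivAt_mul_log_sum_exp {α : Type*} {t : Finset α} (ht : t.Nonempty) {c : ℝ}
    (hc : c ≠ 0) {g : ℝ → α → ℝ} {g' : α → ℝ} {l : ℝ}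
    (hg : ∀ x ∈ t, HasDerivAt (fun s => g s x) (g' x) l) :
    HasDerivAt (fun s => c * Real.log (∑ x ∈ t, Real.exp (g s x / c)))
      (∑ x ∈ t, Real.exp (g l x / c) / (∑ z ∈ t, Real.exp (g l z / c)) * g' x) l := by
  have hpos : 0 < ∑ x ∈ t, Real.exp (g l x / c) :=
    Finset.sum_pos (fun _ _ => Real.exp_pos _) ht
  have hsum : HasDerivAt (fun s => ∑ x ∈ t, Real.exp (g s x / c))
      (∑ x ∈ t, Real.exp (g l x / c) * (g' x / c)) l :=
    HasDerivAt.fun_sum fun x hx => ((hg x hx).div_const c).exp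
  refine ((hsum.log hpos.ne').const_mul c).congr_deriv ?_
  rw [Finset.sum_div, Finset.mul_sum]
  refine Finset.sum_congr rfl fun x _ => ?_
  field_simp

section

variable {X : ℕ → Type*} [∀ i, Fintype (X i)] [∀ i, DecidableEq (X i)]
  {T : ∀ i, X i → X (i + 1)} {σ : ℕ → ℝ} {L : X 0 → ℝ}

lemma fiber_nonempty {i : ℕ} (hT : Function.Surjective (T i)) (y : X (i + 1)) :
    (Finset.univ.filter (fun x => T i x = y)).Nonempty := by
  obtain ⟨x, hx⟩ := hT y
  exact ⟨x, by simp [hx]⟩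

lemma exp_logWeight_succ_div {n : ℕ} (hT : Function.Surjective (T n)) (lam : ℝ)
    (y : X (n + 1)) :
    Real.exp (logWeight T σ L lam (n + 1) y / sbar σ (n + 1)) =
      (∑ x ∈ Finset.univ.filter (fun x => T n x = y),
        Real.exp (logWeight T σ L lam n x / sbar σ n)) ^ (sbar σ n / sbar σ (n + 1)) := by
  rw [Real.rpow_def_of_pos (Finset.sum_pos (fun _ _ => Real.exp_pos _) (fiber_nonempty hT y)),
    logWeight, mul_div_right_comm, mul_comm]

lemma RGU_eq_of_RGP_eq {n : ℕ} {lam : ℝ}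
    (hP : ∀ x, RGP T σ L lam n x = Real.exp (logWeight T σ L lam n x / sbar σ n) /
      ∑ z, Real.exp (logWeight T σ L lam n z / sbar σ n)) (y : X (n + 1)) :
    RGU T σ L lam n y =
      (∑ x ∈ Finset.univ.filter (fun x => T n x = y),
        Real.exp (logWeight T σ L lam n x / sbar σ n)) /
      ∑ z, Real.exp (logWeight T σ L lam n z / sbar σ n) := by
  simp only [RGU, hP, Finset.sum_div]

lemma RGP_succ (lam : ℝ) (n : ℕ) (y : X (n + 1)) :
    RGP T σ L lam (n + 1) y =
      RGU T σ L lam n y ^ (sbar σ n / sbar σ (n + 1)) / RGZ T σ L lam (n + 1) := rfl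

/-- Integrating `L` against the disintegration below a level-`n` density `f` amounts to
integrating the conditional expectation of `L` against `f`. -/
lemma sum_disintegration_mul (lam : ℝ) (n : ℕ) (f : X n → ℝ) :
    ∑ x, (f (liftT T n x) * ∏ i ∈ Finset.range n,
      (RGP T σ L lam i (liftT T i x) / RGU T σ L lam i (liftT T (i + 1) x))) * L x =
    ∑ y, f y * condLoss T σ L lam n y := by
  induction n with
  | zero => simp [liftT, condLoss]
  | succ n ih =>
    have h := ih fun y => f (T n y) * (RGP T σ L lam n y / RGU T σ L lam n (T n y))
    calc _ = ∑ y, f (T n y) * (RGP T σ L lam n y / RGU T σ L lam n (T n y)) *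
          condLoss T σ L lam n y := by
          rw [← h]
          refine Finset.sum_congr rfl fun x _ => ?_
          rw [Finset.prod_range_succ]
          simp only [liftT]
          ring
      _ = _ := by
          rw [← Finset.sum_fiberwise (s := Finset.univ) (g := T n)]
          refine Finset.sum_congr rfl fun y _ => ?_
          rw [condLoss, Finset.mul_sum]
          refine Finset.sum_congr rfl fun x hx => ?_
          rw [(Finset.mem_filter.mp hx).2]
          ring

variable [∀ i, Nonempty (X i)]

lemma sum_exp_logWeight_pos (lam : ℝ) (n : ℕ) :
    0 < ∑ z, Real.exp (logWeight T σ L lam n z / sbar σ n) :=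
  Finset.sum_pos (fun _ _ => Real.exp_pos _) Finset.univ_nonempty

lemma RGU_rpow_eq {n : ℕ} (hT : Function.Surjective (T n)) {lam : ℝ}
    (hP : ∀ x, RGP T σ L lam n x = Real.exp (logWeight T σ L lam n x / sbar σ n) /
      ∑ z, Real.exp (logWeight T σ L lam n z / sbar σ n)) (y : X (n + 1)) :
    RGU T σ L lam n y ^ (sbar σ n / sbar σ (n + 1)) =
      Real.exp (logWeight T σ L lam (n + 1) y / sbar σ (n + 1)) /
      (∑ z, Real.exp (logWeight T σ L lam n z / sbar σ n)) ^ (sbar σ n / sbar σ (n + 1)) := by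
  rw [RGU_eq_of_RGP_eq hP, exp_logWeight_succ_div hT,
    Real.div_rpow (Finset.sum_nonneg fun _ _ => (Real.exp_pos _).le)
      (sum_exp_logWeight_pos lam n).le]

lemma RGZ_succ_eq {n : ℕ} (hT : Function.Surjective (T n)) {lam : ℝ}
    (hP : ∀ x, RGP T σ L lam n x = Real.exp (logWeight T σ L lam n x / sbar σ n) /
      ∑ z, Real.exp (logWeight T σ L lam n z / sbar σ n)) :
    RGZ T σ L lam (n + 1) =
      (∑ z, Real.exp (logWeight T σ L lam (n + 1) z / sbar σ (n + 1))) /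
      (∑ z, Real.exp (logWeight T σ L lam n z / sbar σ n)) ^ (sbar σ n / sbar σ (n + 1)) := by
  simp only [RGZ, RGU_rpow_eq hT hP, Finset.sum_div]

/-- The iterates are the Gibbs distributions of the log-weights. -/
lemma RGP_eq_exp_logWeight (n : ℕ) (hT : ∀ i < n, Function.Surjective (T i)) (lam : ℝ)
    (x : X n) :
    RGP T σ L lam n x = Real.exp (logWeight T σ L lam n x / sbar σ n) /
      ∑ z, Real.exp (logWeight T σ L lam n z / sbar σ n) := by
  induction n with
  | zero =>
    have h (z : X 0) : -(lam / σ 0) * L z = -lam * L z / σ 0 := by ring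
    simp [RGP, logWeight, sbar, h]
  | succ n ih =>
    have hP := ih fun i hi => hT i (hi.trans n.lt_succ_self)
    have hTn := hT n n.lt_succ_self
    rw [RGP_succ, RGU_rpow_eq hTn hP, RGZ_succ_eq hTn hP,
      div_div_div_cancel_right₀ (Real.rpow_pos_of_pos (sum_exp_logWeight_pos lam n) _).ne']

/-- The accumulated log-partition function is the log-partition function of the
log-weights. -/
lemma sum_sbar_mul_log_RGZ (n : ℕ) (hT : ∀ i < n, Function.Surjective (T i))
    (hσ : ∀ i ≤ n, 0 < σ i) (lam : ℝ) :
    ∑ i ∈ Finset.range (n + 1), sbar σ i * Real.log (RGZ T σ L lam i) =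
      sbar σ n * Real.log (∑ z, Real.exp (logWeight T σ L lam n z / sbar σ n)) := by
  induction n with
  | zero =>
    have h (z : X 0) : -(lam / σ 0) * L z = -lam * L z / σ 0 := by ring
    simp [RGZ, logWeight, sbar, h]
  | succ n ih =>
    have hS := sum_exp_logWeight_pos (T := T) (σ := σ) (L := L) lam n
    have hs := (sbar_pos hσ).ne'
    rw [Finset.sum_range_succ, ih (fun i hi => hT i (by omega)) (fun i hi => hσ i (by omega)),
      RGZ_succ_eq (hT n n.lt_succ_self) (RGP_eq_exp_logWeight n (fun i hi => hT i (by omega)) lam),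
      Real.log_div (sum_exp_logWeight_pos lam (n + 1)).ne' (Real.rpow_pos_of_pos hS _).ne',
      Real.log_rpow hS]
    field_simp
    ring

lemma hasDerivAt_logWeight (n : ℕ) (hT : ∀ i < n, Function.Surjective (T i))
    (hσ : ∀ i ≤ n, 0 < σ i) (lam : ℝ) (y : X n) :
    HasDerivAt (fun l => logWeight T σ L l n y) (-condLoss T σ L lam n y) lam := by
  induction n with
  | zero =>
    simpa [logWeight, condLoss] using ((hasDerivAt_id lam).neg.mul_const (L y))
  | succ n ih =>
    have hT' : ∀ i < n, Function.Surjective (T i) := fun i hi => hT i (by omega)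
    have hσ' : ∀ i ≤ n, 0 < σ i := fun i hi => hσ i (by omega)
    have hP := RGP_eq_exp_logWeight (σ := σ) (L := L) n hT' lam
    refine (hasDerivAt_mul_log_sum_exp (fiber_nonempty (hT n n.lt_succ_self) y)
      (sbar_pos hσ').ne' (fun x _ => ih hT' hσ' x)).congr_deriv ?_
    rw [condLoss, ← Finset.sum_neg_distrib]
    refine Finset.sum_congr rfl fun x _ => ?_
    rw [RGU_eq_of_RGP_eq hP, hP,
      div_div_div_cancel_right₀ (sum_exp_logWeight_pos lam n).ne', mul_neg]

lemma hasDerivAt_sum_sbar_mul_log_RGZ (n : ℕ) (hT : ∀ i < n, Function.Surjective (T i))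
    (hσ : ∀ i ≤ n, 0 < σ i) (lam : ℝ) :
    HasDerivAt (fun l => ∑ i ∈ Finset.range (n + 1), sbar σ i * Real.log (RGZ T σ L l i))
      (-∑ x, Ptilde T σ L lam (n + 1) x * L x) lam := by
  simp only [sum_sbar_mul_log_RGZ n hT hσ]
  refine (hasDerivAt_mul_log_sum_exp Finset.univ_nonempty (sbar_pos hσ).ne'
    (fun x _ => hasDerivAt_logWeight n hT hσ lam x)).congr_deriv ?_
  have h : ∑ x, Ptilde T σ L lam (n + 1) x * L x =
      ∑ y, RGP T σ L lam n y * condLoss T σ L lam n y :=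
    sum_disintegration_mul lam n (RGP T σ L lam n)
  simp only [h, mul_neg, Finset.sum_neg_distrib, RGP_eq_exp_logWeight n hT]

end

/-- Envelope theorem for the hierarchical maximum entropy problem: the map
`λ ↦ ∑ σ̄_i log Z_i(λ)` is differentiable with derivative `-E_{P̃^{[λ]}}[L]`;
in particular its derivative is `-μ` at any `λ*` meeting the mean constraint. -/
theorem stmt_8 (d : ℕ) (hd : 1 ≤ d) (X : ℕ → Type*) [∀ i, Fintype (X i)]
    [∀ i, Nonempty (X i)] [∀ i, DecidableEq (X i)]
    (T : ∀ i, X i → X (i + 1)) (hT : ∀ i, i < d - 1 → Function.Surjective (T i))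
    (σ : ℕ → ℝ) (hσ : ∀ i, i < d → 0 < σ i) (L : X 0 → ℝ) :
    ∀ lam : ℝ,
      HasDerivAt (fun l => ∑ i ∈ Finset.range d, sbar σ i * Real.log (RGZ T σ L l i))
        (-∑ x, Ptilde T σ L lam d x * L x) lam ∧
      ∀ μ : ℝ, ∑ x, Ptilde T σ L lam d x * L x = μ →
        HasDerivAt (fun l => ∑ i ∈ Finset.range d, sbar σ i * Real.log (RGZ T σ L l i))
          (-μ) lam := by
  intro lam
  obtain ⟨n, rfl⟩ : ∃ n, d = n + 1 := ⟨d - 1, by omega⟩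
  have h := hasDerivAt_sum_sbar_mul_log_RGZ (L := L) n hT
    (fun i hi => hσ i (Nat.lt_succ_of_le hi)) lam
  exact ⟨h, fun μ hμ => hμ ▸ h⟩
end

section
/- Let k ≥ 1, i ≥ 2, and let A, B be k×k real matrices with A symmetric. Suppose the (ik)×(ik) block Toeplitz matrix M := 𝒯_i[A,B] is positive definite, and let N₁₁ denote the top-left ((i−1)k)×((i−1)k) submatrix of M⁻¹ (the block of M⁻¹ indexed by the first i−1 block rows and columns). Then A is invertible, the matrix 𝒯_{i−1}[A − BᵀA⁻¹B, B − BᵀA⁻¹B] is invertible, and N₁₁ = (𝒯_{i−1}[A − BᵀA⁻¹B, B − BᵀA⁻¹B])⁻¹. -/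
open Matrix

/-- The block Toeplitz matrix `𝒯_i[A,B]`: the `(a,b)` block (of size `k×k`)
equals `A` if `a = b`, `Bᵀ` if `a < b`, and `B` if `a > b`. -/
def blockToeplitz (k i : ℕ) (A B : Matrix (Fin k) (Fin k) ℝ) :
    Matrix (Fin i × Fin k) (Fin i × Fin k) ℝ :=
  Matrix.of fun p q =>
    if p.1 = q.1 then A p.2 q.2
    else if (p.1 : ℕ) < (q.1 : ℕ) then Bᵀ p.2 q.2
    else B p.2 q.2

/-- Splits off the last block of an index in `Fin (n + 1) × Fin k`. -/
noncomputable def lastBlockEquiv (n k : ℕ) : (Fin n × Fin k) ⊕ Fin k ≃ Fin (n + 1) × Fin k :=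
  Equiv.ofBijective (Sum.elim (fun p => (p.1.castSucc, p.2)) fun x => (Fin.last n, x)) <| by
    constructor
    · rintro (⟨a, x⟩ | x) (⟨b, y⟩ | y) h <;>
        simp_all [Fin.castSucc_ne_last, (Fin.castSucc_ne_last _).symm]
    · rintro ⟨a, x⟩
      induction a using Fin.lastCases with
      | last => exact ⟨Sum.inr x, rfl⟩
      | cast a => exact ⟨Sum.inl (a, x), rfl⟩

@[simp]
theorem lastBlockEquiv_inl (n k : ℕ) (p : Fin n × Fin k) :
    lastBlockEquiv n k (Sum.inl p) = (p.1.castSucc, p.2) := rfl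

@[simp]
theorem lastBlockEquiv_inr (n k : ℕ) (x : Fin k) :
    lastBlockEquiv n k (Sum.inr x) = (Fin.last n, x) := rfl

theorem blockToeplitz_submatrix_lastBlockEquiv (n k : ℕ) (A B : Matrix (Fin k) (Fin k) ℝ) :
    (blockToeplitz k (n + 1) A B).submatrix (lastBlockEquiv n k) (lastBlockEquiv n k) =
      fromBlocks (blockToeplitz k n A B) (Bᵀ.submatrix Prod.snd id) (B.submatrix id Prod.snd) A := by
  ext (⟨a, x⟩ | x) (⟨b, y⟩ | y)
  · simp [blockToeplitz]
  · simp [blockToeplitz, Fin.castSucc_ne_last]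
  · simp [blockToeplitz, (Fin.castSucc_ne_last _).symm, (Fin.castSucc_lt_last b).not_gt]
  · simp [blockToeplitz]

theorem blockToeplitz_sub_schur (n k : ℕ) {A B : Matrix (Fin k) (Fin k) ℝ} (hA : A.IsSymm) :
    blockToeplitz k n A B -
        Bᵀ.submatrix (Prod.snd : Fin n × Fin k → Fin k) id * A⁻¹ * B.submatrix id Prod.snd =
      blockToeplitz k n (A - Bᵀ * A⁻¹ * B) (B - Bᵀ * A⁻¹ * B) := by
  have hS : (Bᵀ * A⁻¹ * B)ᵀ = Bᵀ * A⁻¹ * B := by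
    simp [transpose_nonsing_inv, hA.eq, Matrix.mul_assoc]
  have hsub : Bᵀ.submatrix (Prod.snd : Fin n × Fin k → Fin k) id * A⁻¹ *
      B.submatrix id (Prod.snd : Fin n × Fin k → Fin k) =
      (Bᵀ * A⁻¹ * B).submatrix Prod.snd Prod.snd := rfl
  ext p q
  simp only [hsub, blockToeplitz, of_apply, Matrix.sub_apply, submatrix_apply, transpose_sub, hS]
  split_ifs <;> rfl

theorem isUnit_schur_and_toBlocks₁₁_inv {m n : Type*} [Fintype m] [DecidableEq m] [Fintype n]
    [DecidableEq n] (P : Matrix m m ℝ) (Q : Matrix m n ℝ) (R : Matrix n m ℝ) (D : Matrix n n ℝ)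
    (hD : IsUnit D) (hM : IsUnit (fromBlocks P Q R D)) :
    IsUnit (P - Q * D⁻¹ * R) ∧ (fromBlocks P Q R D)⁻¹.toBlocks₁₁ = (P - Q * D⁻¹ * R)⁻¹ := by
  have := hD.invertible
  have := hM.invertible
  have hS : IsUnit (P - Q * ⅟D * R) := isUnit_fromBlocks_iff_of_invertible₂₂.1 hM
  have := hS.invertible
  rw [← invOf_eq_nonsing_inv D, ← invOf_eq_nonsing_inv (fromBlocks P Q R D),
    invOf_fromBlocks₂₂_eq, toBlocks_fromBlocks₁₁, invOf_eq_nonsing_inv (P - _)]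
  exact ⟨hS, rfl⟩

/-- Marginalizing out the last block preserves the modular structure: if
`M = 𝒯_i[A,B]` is positive definite with `A` symmetric, then `A` is invertible
and the top-left `(i-1)×(i-1)`-block submatrix of `M⁻¹` is the inverse of
`𝒯_{i-1}[A - BᵀA⁻¹B, B - BᵀA⁻¹B]`. -/
theorem stmt_9 (k i : ℕ) (hk : 1 ≤ k) (hi : 2 ≤ i)
    (A B : Matrix (Fin k) (Fin k) ℝ) (hA : A.IsSymm)
    (hM : (blockToeplitz k i A B).PosDef) :
    IsUnit A.det ∧
    IsUnit (blockToeplitz k (i - 1) (A - Bᵀ * A⁻¹ * B) (B - Bᵀ * A⁻¹ * B)).det ∧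
    ((blockToeplitz k i A B)⁻¹).submatrix
        (fun p : Fin (i - 1) × Fin k => (Fin.castLE (Nat.sub_le i 1) p.1, p.2))
        (fun p : Fin (i - 1) × Fin k => (Fin.castLE (Nat.sub_le i 1) p.1, p.2)) =
      (blockToeplitz k (i - 1) (A - Bᵀ * A⁻¹ * B) (B - Bᵀ * A⁻¹ * B))⁻¹ := by
  obtain ⟨n, rfl⟩ : ∃ n, i = n + 1 := ⟨i - 1, by omega⟩
  have hMe := hM.submatrix (lastBlockEquiv n k).injective
  have hAu : IsUnit A := by
    have := (hMe.submatrix Sum.inr_injective).isUnit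
    rw [blockToeplitz_submatrix_lastBlockEquiv] at this
    exact this
  have hu := hMe.isUnit
  rw [blockToeplitz_submatrix_lastBlockEquiv] at hu
  have h := isUnit_schur_and_toBlocks₁₁_inv _ _ _ _ hAu hu
  rw [blockToeplitz_sub_schur n k hA, ← blockToeplitz_submatrix_lastBlockEquiv,
    inv_submatrix_equiv] at h
  exact ⟨(isUnit_iff_isUnit_det _).1 hAu, (isUnit_iff_isUnit_det _).1 h.1, h.2⟩
end

section
/- Let m ≥ 1, θ ∈ ℝ, and let y : ZMod m → ℝ satisfy y_j ∈ {−1, 1} for every j. Then ∑_{z} exp(θ · ∑_{j ∈ ZMod m} z_j (y_j + y_{j+1})) = (2 √(cosh(2θ)))^m · exp(θ′ · ∑_{j ∈ ZMod m} y_j y_{j+1}), where the outer sum runs over all functions z : ZMod m → {−1, 1} and θ′ := ½ log(cosh(2θ)). -/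
/-- Summing out a spin `s = ±1` lying between two spins `a, b = ±1`. -/
theorem exp_decimate_spin (θ : ℝ) {a b : ℝ} (ha : a = -1 ∨ a = 1) (hb : b = -1 ∨ b = 1) :
    ∑ s ∈ ({-1, 1} : Finset ℝ), Real.exp (θ * (s * (a + b))) =
      2 * Real.sqrt (Real.cosh (2 * θ)) *
        Real.exp (1 / 2 * Real.log (Real.cosh (2 * θ)) * (a * b)) := by
  have hc := Real.cosh_pos (2 * θ)
  have hsqrt : Real.exp (1 / 2 * Real.log (Real.cosh (2 * θ))) =
      Real.sqrt (Real.cosh (2 * θ)) := by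
    rw [Real.sqrt_eq_rpow, Real.rpow_def_of_pos hc, mul_comm]
  have hsq := Real.mul_self_sqrt hc.le
  have hcosh := Real.cosh_eq (2 * θ)
  have hne := (Real.sqrt_pos.2 hc).ne'
  rw [Finset.sum_pair (by norm_num)]
  rcases ha with rfl | rfl <;> rcases hb with rfl | rfl
  · rw [show (-1 : ℝ) * -1 = 1 by norm_num, mul_one, hsqrt, mul_assoc, hsq, hcosh]
    ring_nf
  · rw [show (-1 : ℝ) * 1 = -1 by norm_num, mul_neg_one, Real.exp_neg, hsqrt,
      mul_assoc, mul_inv_cancel₀ hne]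
    norm_num
  · rw [show (1 : ℝ) * -1 = -1 by norm_num, mul_neg_one, Real.exp_neg, hsqrt,
      mul_assoc, mul_inv_cancel₀ hne]
    norm_num
  · rw [show (1 : ℝ) * 1 = 1 by norm_num, mul_one, hsqrt, mul_assoc, hsq, hcosh]
    ring_nf

/-- Decimation step for the one-dimensional Ising model with periodic boundary
conditions: summing the Boltzmann weight over the decimated spins
`z : ZMod m → {-1, 1}` yields a nearest-neighbor Ising weight on the remaining
`m` spins `y` with renormalized coupling `θ' = ½ log cosh 2θ`. -/
theorem stmt_13 (m : ℕ) (hm : 1 ≤ m) [NeZero m] (θ : ℝ) (y : ZMod m → ℝ)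
    (hy : ∀ j, y j = -1 ∨ y j = 1) :
    ∑ z : ZMod m → ({-1, 1} : Finset ℝ),
        Real.exp (θ * ∑ j : ZMod m, (z j : ℝ) * (y j + y (j + 1))) =
      (2 * Real.sqrt (Real.cosh (2 * θ))) ^ m *
        Real.exp (1 / 2 * Real.log (Real.cosh (2 * θ)) * ∑ j : ZMod m, y j * y (j + 1)) := by
  simp_rw [Finset.mul_sum, Real.exp_sum]
  rw [← Fintype.piFinset_univ, ← Finset.prod_univ_sum (fun _ => Finset.univ)
    (fun (j : ZMod m) (s : ({-1, 1} : Finset ℝ)) =>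
      Real.exp (θ * ((s : ℝ) * (y j + y (j + 1)))))]
  have hsite (j : ZMod m) :
      ∑ s : ({-1, 1} : Finset ℝ), Real.exp (θ * ((s : ℝ) * (y j + y (j + 1)))) =
        2 * Real.sqrt (Real.cosh (2 * θ)) *
          Real.exp (1 / 2 * Real.log (Real.cosh (2 * θ)) * (y j * y (j + 1))) :=
    (Finset.sum_coe_sort _ fun s : ℝ => Real.exp (θ * (s * (y j + y (j + 1))))).trans
      (exp_decimate_spin θ (hy j) (hy (j + 1)))
  simp_rw [hsite]
  rw [Finset.prod_mul_distrib, Finset.prod_const, Finset.card_univ, ZMod.card]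
end
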